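/- Let x be a nonzero complex number and N a nonnegative integer that is not triangular (i.e., N ≠ k(k+1)/2 for every nonnegative integer k). Then for every integer M ≥ N, the coefficient of q^N in the polynomial ∏_{n=1}^M (1 − q^n)(1 + x q^n)(1 + x^{-1} q^n) is 0. -/

import Mathlib

open Polynomial in
/-- Gaussian binomial coefficients, defined by the `q`-Pascal recursion. -/
noncomputable def gaussBinom (R : Type*) [CommRing R] : ℕ → ℕ → R[X]
  | _, 0 => 1
  | 0, _ + 1 => 0
  | n + 1, k + 1 => X ^ (k + 1) * gaussBinom R n (k + 1) + gaussBinom R n k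

open Polynomial in
/-- The finite `q`-Pochhammer product `(1 - q) (1 - q ^ 2) ⋯ (1 - q ^ n)`. -/
noncomputable def qPochhammer (R : Type*) [CommRing R] (n : ℕ) : R[X] :=
  ∏ i ∈ Finset.range n, (1 - X ^ (i + 1))

section ThetaProduct

open Polynomial Finset

section CommRing

variable {R : Type*} [CommRing R]

lemma gaussBinom_zero_right (n : ℕ) : gaussBinom R n 0 = 1 := by
  cases n <;> rfl

lemma gaussBinom_succ_succ (n k : ℕ) : gaussBinom R (n + 1) (k + 1) =
    X ^ (k + 1) * gaussBinom R n (k + 1) + gaussBinom R n k := rfl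

lemma gaussBinom_eq_zero_of_lt {n k : ℕ} (h : n < k) : gaussBinom R n k = 0 := by
  induction n generalizing k with
  | zero =>
    obtain ⟨k, rfl⟩ := Nat.exists_eq_succ_of_ne_zero h.ne'
    rfl
  | succ n ih =>
    obtain ⟨k, rfl⟩ := Nat.exists_eq_succ_of_ne_zero (Nat.ne_zero_of_lt h)
    rw [Nat.succ_eq_add_one, gaussBinom_succ_succ, ih (by omega), ih (by omega)]
    simp

/-- The homogeneous `q`-binomial theorem. -/
lemma prod_range_add_mul_X_pow (n : ℕ) (a b : R[X]) :
    ∏ i ∈ range n, (b + a * X ^ i) =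
      ∑ k ∈ range (n + 1), gaussBinom R n k * X ^ (k.choose 2) * a ^ k * b ^ (n - k) := by
  induction n generalizing a with
  | zero => simp [gaussBinom_zero_right]
  | succ n ih =>
    have hshift : ∏ i ∈ range n, (b + a * X ^ (i + 1)) =
        ∏ i ∈ range n, (b + a * X * X ^ i) :=
      prod_congr rfl fun i _ => by ring
    have hlast : ∑ k ∈ range (n + 1),
        gaussBinom R n k * X ^ (k.choose 2) * (a * X) ^ k * b ^ (n - k) * b =
        ∑ k ∈ range (n + 2),
          gaussBinom R n k * X ^ (k.choose 2) * (a * X) ^ k * b ^ (n + 1 - k) := by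
      rw [sum_range_succ _ (n + 1), gaussBinom_eq_zero_of_lt (Nat.lt_succ_self n)]
      simp only [zero_mul, add_zero]
      refine sum_congr rfl fun k hk => ?_
      rw [Nat.succ_sub (Nat.lt_succ_iff.mp (mem_range.mp hk)), pow_succ b, mul_assoc _ _ b]
    rw [prod_range_succ', hshift, ih, mul_add, sum_mul, hlast, sum_range_succ' _ (n + 1),
      sum_range_succ' _ (n + 1), sum_mul, add_right_comm, ← sum_add_distrib]
    congr 1
    · refine sum_congr rfl fun k _ => ?_
      rw [gaussBinom_succ_succ, Nat.choose_succ_succ' k 1, Nat.choose_one_right,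
        Nat.add_sub_add_right]
      ring
    · simp [gaussBinom_zero_right]

lemma qPochhammer_succ (n : ℕ) :
    qPochhammer R (n + 1) = qPochhammer R n * (1 - X ^ (n + 1)) :=
  prod_range_succ _ _

lemma qPochhammer_mul_mul_gaussBinom (k l : ℕ) :
    qPochhammer R k * qPochhammer R l * gaussBinom R (k + l) k = qPochhammer R (k + l) := by
  induction k generalizing l with
  | zero => simp [gaussBinom_zero_right, qPochhammer]
  | succ k ihk =>
    induction l with
    | zero =>
      have h := ihk 0
      rw [add_zero] at h
      rw [add_zero, gaussBinom_succ_succ, gaussBinom_eq_zero_of_lt (Nat.lt_succ_self k),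
        qPochhammer_succ]
      linear_combination (1 - X ^ (k + 1)) * h
    | succ l ihl =>
      have h := ihk (l + 1)
      rw [← add_assoc] at h ⊢
      rw [show k + 1 + l = k + l + 1 by omega] at ihl ⊢
      rw [gaussBinom_succ_succ, qPochhammer_succ (k + l + 1)]
      have hk := qPochhammer_succ (R := R) k
      have hl := qPochhammer_succ (R := R) l
      linear_combination X ^ (k + 1) * (1 - X ^ (l + 1)) * ihl + (1 - X ^ (k + 1)) * h +
        X ^ (k + 1) * qPochhammer R (k + 1) * gaussBinom R (k + l + 1) (k + 1) * hl +
        qPochhammer R (l + 1) * gaussBinom R (k + l + 1) k * hk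

lemma X_pow_dvd_qPochhammer_sub {c n : ℕ} (h : c ≤ n) :
    (X : R[X]) ^ (c + 1) ∣ qPochhammer R n - qPochhammer R c := by
  induction n, h using Nat.le_induction with
  | base => simp
  | succ n hn ih =>
    have h : qPochhammer R (n + 1) - qPochhammer R c =
        (qPochhammer R n - qPochhammer R c) - X ^ (n + 1) * qPochhammer R n := by
      rw [qPochhammer_succ]
      ring
    rw [h]
    exact dvd_sub ih ((pow_dvd_pow X (by omega)).mul_right _)

lemma isCoprime_X_pow_qPochhammer (m n : ℕ) : IsCoprime ((X : R[X]) ^ m) (qPochhammer R n) :=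
  IsCoprime.pow_left <| IsCoprime.prod_right fun i _ => ⟨X ^ i, 1, by ring⟩

lemma X_pow_dvd_qPochhammer_mul_gaussBinom_sub_one {a b c m : ℕ} (ha : c ≤ a) (hb : c ≤ b)
    (hm : c ≤ m) :
    (X : R[X]) ^ (c + 1) ∣ qPochhammer R m * gaussBinom R (a + b) a - 1 := by
  refine (isCoprime_X_pow_qPochhammer (R := R) (c + 1) c).dvd_of_dvd_mul_left ?_
  obtain ⟨u, hu⟩ := X_pow_dvd_qPochhammer_sub (R := R) ha
  obtain ⟨v, hv⟩ := X_pow_dvd_qPochhammer_sub (R := R) hb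
  obtain ⟨w, hw⟩ := X_pow_dvd_qPochhammer_sub (R := R) hm
  obtain ⟨z, hz⟩ := X_pow_dvd_qPochhammer_sub (R := R) (ha.trans (Nat.le_add_right a b))
  have h := qPochhammer_mul_mul_gaussBinom (R := R) a b
  refine ⟨z + gaussBinom R (a + b) a * (qPochhammer R c * w - qPochhammer R b * u -
    qPochhammer R c * v), ?_⟩
  linear_combination h + hz + gaussBinom R (a + b) a * (qPochhammer R c * hw -
    qPochhammer R b * hu - qPochhammer R c * hv)

lemma coeff_qPochhammer_mul_gaussBinom_eq_zero {a b c m d : ℕ} (ha : c ≤ a) (hb : c ≤ b)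
    (hm : c ≤ m) (hd : d ≠ 0) (hdc : d ≤ c) :
    (qPochhammer R m * gaussBinom R (a + b) a).coeff d = 0 := by
  have h := X_pow_dvd_iff.mp
    (X_pow_dvd_qPochhammer_mul_gaussBinom_sub_one (R := R) ha hb hm) d (by omega)
  rwa [coeff_sub, coeff_one, if_neg hd, sub_zero] at h

end CommRing

lemma choose_two_add_mul_of_upper (m j : ℕ) :
    (m + j + 1 + j).choose 2 + (m + j) * m =
      (m + j).choose 2 + (m + j) * (m + j + 1) + (j + 1).choose 2 := by
  qify
  simp only [Nat.cast_choose_two]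
  push_cast
  ring

lemma choose_two_add_mul_of_lower (k i : ℕ) :
    k.choose 2 + (k + i) * (k + i + 1 + i) =
      (k + i).choose 2 + (k + i) * (k + i + 1) + (i + 1).choose 2 := by
  qify
  simp only [Nat.cast_choose_two]
  push_cast
  ring

lemma self_le_choose_two_succ (j : ℕ) : j ≤ (j + 1).choose 2 := by
  rw [Nat.choose_succ_succ' j 1, Nat.choose_one_right]
  omega

lemma coeff_qPochhammer_mul_gaussBinom_mul_X_pow {R : Type*} [CommRing R] {N M k : ℕ}
    (hN : ∀ j : ℕ, N ≠ (j + 1).choose 2) (hM : N ≤ M) (hk : k ≤ 2 * M + 1) :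
    (qPochhammer R M * gaussBinom R (2 * M + 1) k *
      X ^ (k.choose 2 + M * (2 * M + 1 - k))).coeff (N + (M.choose 2 + M * (M + 1))) = 0 := by
  have key : ∀ j a b c : ℕ, a + b = 2 * M + 1 → a = k →
      k.choose 2 + M * (2 * M + 1 - k) = M.choose 2 + M * (M + 1) + (j + 1).choose 2 →
      c ≤ a → c ≤ b → c ≤ M → M ≤ c + j →
      (qPochhammer R M * gaussBinom R (2 * M + 1) k *
        X ^ (k.choose 2 + M * (2 * M + 1 - k))).coeff (N + (M.choose 2 + M * (M + 1))) = 0 := by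
    intro j a b c hab hak hexp ha hb hc hMc
    subst hak
    have hj := self_le_choose_two_succ j
    have hNj := hN j
    rw [hexp, coeff_mul_X_pow', ← hab]
    split_ifs with h
    · exact coeff_qPochhammer_mul_gaussBinom_eq_zero ha hb hc (by omega) (by omega)
    · rfl
  rcases le_or_gt k M with h | h
  · obtain ⟨i, rfl⟩ := Nat.exists_eq_add_of_le h
    refine key i k (k + i + 1 + i) k (by omega) rfl ?_ le_rfl (by omega) (by omega) le_rfl
    rw [← choose_two_add_mul_of_lower]
    congr 2
    omega
  · obtain ⟨j, rfl⟩ := Nat.exists_eq_add_of_le (Nat.succ_le_of_lt h)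
    obtain ⟨m, rfl⟩ := Nat.exists_eq_add_of_le' (show j ≤ M by omega)
    refine key j _ m m (by omega) rfl ?_ (by omega) le_rfl (by omega) le_rfl
    rw [← choose_two_add_mul_of_upper]
    congr 2
    omega

variable {K : Type*} [Field K]

lemma prod_range_X_pow_add (M : ℕ) {x : K} (hx : x ≠ 0) :
    ∏ i ∈ range (2 * M + 1), (X ^ M + C x * X ^ i) =
      C (x ^ M) * (1 + C x) *
        (∏ n ∈ Icc 1 M, ((1 + C x * X ^ n) * (1 + C x⁻¹ * X ^ n))) *
        X ^ (M.choose 2 + M * (M + 1)) := by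
  have hlow : ∏ i ∈ range M, (X ^ M + C x * X ^ i) =
      X ^ (M.choose 2) * C (x ^ M) * ∏ i ∈ range M, (1 + C x⁻¹ * X ^ (i + 1)) := by
    have hconst : C (x ^ M) = ∏ _i ∈ range M, C x := by simp
    rw [← prod_range_reflect (fun i => 1 + C x⁻¹ * X ^ (i + 1)), Nat.choose_two_right,
      ← sum_range_id, ← prod_pow_eq_pow_sum, hconst, ← prod_mul_distrib, ← prod_mul_distrib]
    refine prod_congr rfl fun i hi => ?_
    have hi := mem_range.mp hi
    have hC : C x * C x⁻¹ = 1 := by rw [← C_mul, mul_inv_cancel₀ hx, C_1]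
    have hX : (X : K[X]) ^ M = X ^ i * X ^ (M - 1 - i + 1) := by
      rw [← pow_add]
      congr 1
      omega
    linear_combination hX - X ^ i * X ^ (M - 1 - i + 1) * hC
  have hhigh : ∏ i ∈ range (M + 1), (X ^ M + C x * X ^ (M + i)) =
      X ^ (M * (M + 1)) * ((∏ i ∈ range M, (1 + C x * X ^ (i + 1))) * (1 + C x)) := by
    have h : ∏ i ∈ range (M + 1), (X ^ M + C x * X ^ (M + i)) =
        ∏ i ∈ range (M + 1), (X ^ M * (1 + C x * X ^ i)) :=
      prod_congr rfl fun i _ => by ring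
    rw [h, prod_mul_distrib, prod_const, card_range, pow_mul, prod_range_succ', pow_zero, mul_one]
  have hIcc : ∏ n ∈ Icc 1 M, ((1 + C x * X ^ n) * (1 + C x⁻¹ * X ^ n)) =
      (∏ i ∈ range M, (1 + C x * X ^ (i + 1))) * ∏ i ∈ range M, (1 + C x⁻¹ * X ^ (i + 1)) := by
    rw [← prod_mul_distrib, range_eq_Ico,
      prod_Ico_add' (fun n => (1 + C x * X ^ n) * (1 + C x⁻¹ * X ^ n)) 0 M 1]
    rfl
  rw [show 2 * M + 1 = M + (M + 1) by omega, prod_range_add, hlow, hhigh, hIcc, pow_add]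
  ring

lemma theta_prod_eq (x : K) (M : ℕ) :
    ∏ n ∈ Icc 1 M, ((1 - X ^ n) * (1 + C x * X ^ n) * (1 + C x⁻¹ * X ^ n)) =
      qPochhammer K M * ∏ n ∈ Icc 1 M, ((1 + C x * X ^ n) * (1 + C x⁻¹ * X ^ n)) := by
  have h : qPochhammer K M = ∏ n ∈ Icc 1 M, (1 - X ^ n) := by
    rw [qPochhammer, range_eq_Ico, prod_Ico_add' (fun n => (1 : K[X]) - X ^ n) 0 M 1]
    rfl
  rw [h, ← prod_mul_distrib]
  exact prod_congr rfl fun n _ => mul_assoc _ _ _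

lemma theta_coeff_eq_zero_of_ne_neg_one {x : K} (hx : x ≠ 0) (hx1 : 1 + x ≠ 0) {N M : ℕ}
    (hN : ∀ j : ℕ, N ≠ (j + 1).choose 2) (hM : N ≤ M) :
    (∏ n ∈ Icc 1 M,
      ((1 - X ^ n) * (1 + C x * X ^ n) * (1 + C x⁻¹ * X ^ n))).coeff N = 0 := by
  have hprod : C (x ^ M * (1 + x)) *
      (∏ n ∈ Icc 1 M, ((1 - X ^ n) * (1 + C x * X ^ n) * (1 + C x⁻¹ * X ^ n))) *
        X ^ (M.choose 2 + M * (M + 1)) =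
      ∑ k ∈ range (2 * M + 1 + 1), C (x ^ k) * (qPochhammer K M * gaussBinom K (2 * M + 1) k *
        X ^ (k.choose 2 + M * (2 * M + 1 - k))) := by
    have h := (prod_range_X_pow_add M hx).symm.trans
      (prod_range_add_mul_X_pow (2 * M + 1) (C x) (X ^ M))
    rw [theta_prod_eq, C_mul, C_add, C_1]
    have hsum : ∑ k ∈ range (2 * M + 1 + 1), C (x ^ k) *
        (qPochhammer K M * gaussBinom K (2 * M + 1) k *
          X ^ (k.choose 2 + M * (2 * M + 1 - k))) =
        qPochhammer K M * ∑ k ∈ range (2 * M + 1 + 1), gaussBinom K (2 * M + 1) k *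
          X ^ (k.choose 2) * C x ^ k * (X ^ M) ^ (2 * M + 1 - k) := by
      rw [mul_sum]
      refine sum_congr rfl fun k _ => ?_
      rw [C_pow, pow_add, pow_mul]
      ring
    rw [hsum, ← h]
    ring
  have hcoeff := congrArg (fun p => p.coeff (N + (M.choose 2 + M * (M + 1)))) hprod
  simp only [coeff_mul_X_pow, coeff_C_mul, finsetSum_coeff] at hcoeff
  rw [sum_eq_zero fun k hk => by
    rw [coeff_qPochhammer_mul_gaussBinom_mul_X_pow hN hM
      (Nat.lt_succ_iff.mp (mem_range.mp hk)), mul_zero]] at hcoeff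
  exact (mul_eq_zero.mp hcoeff).resolve_left (mul_ne_zero (pow_ne_zero _ hx) hx1)

lemma continuousOn_coeff_mul {T R : Type*} [TopologicalSpace T] [Semiring R] [TopologicalSpace R]
    [IsTopologicalSemiring R] {s : Set T} {f g : T → R[X]}
    (hf : ∀ n, ContinuousOn (fun t => (f t).coeff n) s)
    (hg : ∀ n, ContinuousOn (fun t => (g t).coeff n) s) (n : ℕ) :
    ContinuousOn (fun t => (f t * g t).coeff n) s := by
  simp only [coeff_mul]
  exact continuousOn_finsetSum _ fun p _ => (hf p.1).mul (hg p.2)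

lemma continuousOn_coeff_prod {T R ι : Type*} [TopologicalSpace T] [CommSemiring R]
    [TopologicalSpace R] [IsTopologicalSemiring R] {S : Set T} (s : Finset ι) {f : ι → T → R[X]}
    (hf : ∀ i n, ContinuousOn (fun t => (f i t).coeff n) S) (n : ℕ) :
    ContinuousOn (fun t => (∏ i ∈ s, f i t).coeff n) S := by
  classical
  induction s using Finset.induction_on generalizing n with
  | empty => simpa using continuousOn_const
  | insert a s ha ih =>
    simp only [prod_insert ha]
    exact continuousOn_coeff_mul (hf a) ih n

lemma continuousOn_theta_coeff (N M : ℕ) :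
    ContinuousOn (fun x : ℂ => (∏ n ∈ Icc 1 M,
      ((1 - X ^ n) * (1 + C x * X ^ n) * (1 + C x⁻¹ * X ^ n))).coeff N) {0}ᶜ := by
  have hlin : ∀ {g : ℂ → ℂ}, ContinuousOn g {0}ᶜ → ∀ n m : ℕ,
      ContinuousOn (fun x => (1 + C (g x) * X ^ n : ℂ[X]).coeff m) {0}ᶜ := by
    intro g hg n m
    simp only [coeff_add, coeff_C_mul]
    exact continuousOn_const.add (hg.mul continuousOn_const)
  refine continuousOn_coeff_prod (Icc 1 M) (fun n => ?_) N
  refine continuousOn_coeff_mul (continuousOn_coeff_mul (fun _ => continuousOn_const) ?_) ?_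
  · exact hlin (g := fun x => x) continuousOn_id n
  · exact hlin (g := fun x => x⁻¹) continuousOn_inv₀ n

end ThetaProduct

/-- Support property of the theta product: if `N` is not triangular and `x ≠ 0`, then the
coefficient of `q^N` in `∏_{n=1}^M (1 - qⁿ)(1 + x qⁿ)(1 + x⁻¹ qⁿ)` vanishes for any
`M ≥ N`. -/
theorem theta_coeff_eq_zero_of_not_triangular (x : ℂ) (hx : x ≠ 0) (N : ℕ)
    (hN : ∀ k : ℕ, N ≠ k * (k + 1) / 2) (M : ℕ) (hM : N ≤ M) :
    (∏ n ∈ Finset.Icc 1 M,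
      ((1 - Polynomial.X ^ n) * (1 + Polynomial.C x * Polynomial.X ^ n) *
        (1 + Polynomial.C x⁻¹ * Polynomial.X ^ n))).coeff N = 0 := by
  have hN' : ∀ j : ℕ, N ≠ (j + 1).choose 2 := fun j => by
    rw [Nat.choose_two_right, Nat.add_sub_cancel, mul_comm]
    exact hN j
  by_cases hx1 : 1 + x = 0
  · have hcont := (continuousOn_theta_coeff N M).continuousAt
      (isOpen_compl_singleton.mem_nhds hx)
    refine tendsto_nhds_unique_of_eventuallyEq
      (hcont.tendsto.mono_left (nhdsWithin_le_nhds (s := {x}ᶜ))) tendsto_const_nhds ?_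
    filter_upwards [self_mem_nhdsWithin,
      nhdsWithin_le_nhds (isOpen_compl_singleton.mem_nhds hx)] with y hy hy0
    exact theta_coeff_eq_zero_of_ne_neg_one hy0
      (fun h => hy (add_left_cancel (h.trans hx1.symm))) hN' hM
  · exact theta_coeff_eq_zero_of_ne_neg_one hx hx1 hN' hM
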